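/- For every natural number d there exists a natural number f(d) such that every finite simple graph of minimum degree at least f(d) has a star-cover in which every star has size at least d. -/

import Mathlib

open SimpleGraph

/-- The degree of a vertex `v` in a simple graph `H`. -/
noncomputable def gdeg {V : Type} (H : SimpleGraph V) (v : V) : ℕ :=
  Nat.card (H.neighborSet v)

/-- The degree of a vertex `v` in a subgraph `H` of `G`. -/
noncomputable def subdeg {V : Type} {G : SimpleGraph V} (H : G.Subgraph) (v : V) : ℕ :=
  Nat.card (H.neighborSet v)

/-- A subgraph is a star if it is a tree with at most one vertex of degree greater than 1. -/
def IsStar {V : Type} {G : SimpleGraph V} (H : G.Subgraph) : Prop :=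
  H.coe.IsTree ∧ {v ∈ H.verts | 1 < subdeg H v}.Subsingleton

/-- `G` has a star-cover in which every star has size (number of edges) at least `d`:
a collection of vertex-disjoint stars, each a subgraph of `G`, covering all vertices. -/
def HasStarCover {V : Type} (G : SimpleGraph V) (d : ℕ) : Prop :=
  ∃ (m : ℕ) (S : Fin m → G.Subgraph),
    (∀ i, IsStar (S i)) ∧
    (∀ i, d ≤ (S i).edgeSet.ncard) ∧
    (∀ i j, i ≠ j → Disjoint (S i).verts (S j).verts) ∧
    (∀ v, ∃ i, v ∈ (S i).verts)


/-- Finite symmetric local lemma with respect to counting measure. -/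
theorem lll_aux {Ω I : Type} [Fintype Ω] [DecidableEq Ω] [Nonempty Ω] [DecidableEq I]
    (A : I → Finset Ω) (Γ : I → Finset I) (P : ℝ) (D : ℕ) (hP : 0 ≤ P)
    (hD : ∀ i, (Γ i).card ≤ D) (hPD : 4 * P * D ≤ 1)
    (hind : ∀ i (S : Finset I), (∀ j ∈ S, j ∉ Γ i) →
      ((Finset.univ.filter (fun ω => ω ∈ A i ∧ ∀ j ∈ S, ω ∉ A j)).card : ℝ) ≤
        P * (Finset.univ.filter (fun ω => ∀ j ∈ S, ω ∉ A j)).card) :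
    ∀ (n : ℕ) (S : Finset I), S.card = n → ∀ i,
      ((Finset.univ.filter (fun ω => ω ∈ A i ∧ ∀ j ∈ S, ω ∉ A j)).card : ℝ) ≤
        2 * P * (Finset.univ.filter (fun ω => ∀ j ∈ S, ω ∉ A j)).card := by
  intro n
  induction n using Nat.strong_induction_on with
  | _ n ih =>
  intro S hS i
  by_cases hdis : ∀ j ∈ S, j ∉ Γ i
  · have := hind i S hdis
    have h0 : (0:ℝ) ≤ P * (Finset.univ.filter (fun ω => ∀ j ∈ S, ω ∉ A j)).card := by positivity
    linarith
  · push Not at hdis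
    obtain ⟨j0, hj0, hj0'⟩ := hdis
    set S2 := S.filter (fun j => j ∉ Γ i) with hS2
    set S1 := S.filter (fun j => j ∈ Γ i) with hS1
    have hlt : S2.card < n := by
      rw [← hS]
      apply Finset.card_lt_card
      refine ⟨Finset.filter_subset _ _, fun h => ?_⟩
      have := h hj0
      simp [hS2, hj0'] at this
    have h1 : ((Finset.univ.filter (fun ω => ω ∈ A i ∧ ∀ j ∈ S, ω ∉ A j)).card : ℝ) ≤
        (Finset.univ.filter (fun ω => ω ∈ A i ∧ ∀ j ∈ S2, ω ∉ A j)).card := by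
      norm_cast
      apply Finset.card_le_card
      intro ω
      simp only [Finset.mem_filter, Finset.mem_univ, true_and, hS2]
      grind
    have h2 := hind i S2 (by intro j hj; exact (Finset.mem_filter.1 hj).2)
    have h3 : (Finset.univ.filter (fun ω => ∀ j ∈ S2, ω ∉ A j)).card ≤
        (Finset.univ.filter (fun ω => ∀ j ∈ S, ω ∉ A j)).card +
        ∑ k ∈ S1, (Finset.univ.filter (fun ω => ω ∈ A k ∧ ∀ j ∈ S2, ω ∉ A j)).card := by
      refine le_trans (Finset.card_le_card ?_) (le_trans (Finset.card_union_le
        (Finset.univ.filter (fun ω => ∀ j ∈ S, ω ∉ A j))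
        (S1.biUnion (fun k => Finset.univ.filter (fun ω => ω ∈ A k ∧ ∀ j ∈ S2, ω ∉ A j))))
        (Nat.add_le_add_left Finset.card_biUnion_le _))
      intro ω
      simp only [Finset.mem_filter, Finset.mem_univ, true_and, hS2, hS1, Finset.mem_union,
        Finset.mem_biUnion]
      grind
    set M : ℝ := ((Finset.univ.filter (fun ω => ∀ j ∈ S2, ω ∉ A j)).card : ℝ) with hM
    have hM0 : 0 ≤ M := by positivity
    have h4 : (∑ k ∈ S1, (Finset.univ.filter
        (fun ω => ω ∈ A k ∧ ∀ j ∈ S2, ω ∉ A j)).card : ℝ) ≤ D * (2 * P * M) := by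
      refine le_trans (Finset.sum_le_card_nsmul S1 _ (2 * P * M) ?_) ?_
      · intro k _
        exact ih _ hlt S2 rfl k
      · rw [nsmul_eq_mul]
        apply mul_le_mul_of_nonneg_right _ (by positivity)
        norm_cast
        refine le_trans (Finset.card_le_card ?_) (hD i)
        intro j hj
        exact (Finset.mem_filter.1 hj).2
    have h3' : M ≤ (Finset.univ.filter (fun ω => ∀ j ∈ S, ω ∉ A j)).card +
        (∑ k ∈ S1, (Finset.univ.filter
        (fun ω => ω ∈ A k ∧ ∀ j ∈ S2, ω ∉ A j)).card : ℝ) := by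
      rw [hM]; exact_mod_cast h3
    have h5 : D * (2 * P * M) ≤ M / 2 := by nlinarith
    nlinarith

theorem lll {Ω I : Type} [Fintype Ω] [DecidableEq Ω] [Nonempty Ω] [DecidableEq I] [Finite I]
    (A : I → Finset Ω) (Γ : I → Finset I) (P : ℝ) (D : ℕ) (hP : 0 ≤ P) (hP1 : 2 * P < 1)
    (hD : ∀ i, (Γ i).card ≤ D) (hPD : 4 * P * D ≤ 1)
    (hind : ∀ i (S : Finset I), (∀ j ∈ S, j ∉ Γ i) →
      ((Finset.univ.filter (fun ω => ω ∈ A i ∧ ∀ j ∈ S, ω ∉ A j)).card : ℝ) ≤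
        P * (Finset.univ.filter (fun ω => ∀ j ∈ S, ω ∉ A j)).card) :
    ∃ ω, ∀ i, ω ∉ A i := by
  have key : ∀ S : Finset I, 0 < (Finset.univ.filter (fun ω => ∀ j ∈ S, ω ∉ A j)).card := by
    intro S
    induction S using Finset.induction_on with
    | empty => simp [Fintype.card_pos]
    | insert i S _ ih =>
      have h := lll_aux A Γ P D hP hD hPD hind S.card S rfl i
      have h2 : (Finset.univ.filter (fun ω => ∀ j ∈ S, ω ∉ A j)).card ≤
          (Finset.univ.filter (fun ω => ∀ j ∈ insert i S, ω ∉ A j)).card +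
          (Finset.univ.filter (fun ω => ω ∈ A i ∧ ∀ j ∈ S, ω ∉ A j)).card := by
        refine le_trans (Finset.card_le_card ?_) (Finset.card_union_le _ _)
        intro ω
        simp only [Finset.mem_filter, Finset.mem_univ, true_and, Finset.mem_union]
        grind
      have h2' : ((Finset.univ.filter (fun ω => ∀ j ∈ S, ω ∉ A j)).card : ℝ) ≤
          (Finset.univ.filter (fun ω => ∀ j ∈ insert i S, ω ∉ A j)).card +
          (Finset.univ.filter (fun ω => ω ∈ A i ∧ ∀ j ∈ S, ω ∉ A j)).card := by
        exact_mod_cast h2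
      have ih' : (0:ℝ) < (Finset.univ.filter (fun ω => ∀ j ∈ S, ω ∉ A j)).card := by
        exact_mod_cast ih
      have : (0:ℝ) < (Finset.univ.filter (fun ω => ∀ j ∈ insert i S, ω ∉ A j)).card := by
        nlinarith
      exact_mod_cast this
  obtain ⟨U, hU⟩ : ∃ U : Finset I, ∀ i, i ∈ U := by
    cases nonempty_fintype I
    exact ⟨Finset.univ, Finset.mem_univ⟩
  have := key U
  rw [Finset.card_pos] at this
  obtain ⟨ω, hω⟩ := this
  exact ⟨ω, fun i => (Finset.mem_filter.1 hω).2 i (hU i)⟩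

/-- Independence by counting. -/
theorem count_indep {V α : Type} [Fintype V] [DecidableEq V] [Fintype α] [DecidableEq α]
    (N : Finset V) (p : (N → α) → Prop) [DecidablePred p] (s : (V → α) → Prop) [DecidablePred s]
    (hs : ∀ f g : V → α, (∀ v, v ∉ N → f v = g v) → (s f ↔ s g)) (P : ℝ)
    (hp : ((Finset.univ.filter p).card : ℝ) ≤ P * Fintype.card (N → α)) :
    ((Finset.univ.filter (fun f : V → α => p (fun v => f v) ∧ s f)).card : ℝ) ≤
      P * (Finset.univ.filter s).card := by
  classical
  rcases isEmpty_or_nonempty (N → α) with he | ⟨⟨a0⟩⟩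
  · have : IsEmpty (V → α) := ⟨fun f => he.false (fun v => f v)⟩
    simp
  let e := Equiv.piEquivPiSubtypeProd (fun v => v ∈ N) (fun _ : V => α)
  obtain ⟨s', hss⟩ : ∃ s' : ({v // v ∉ N} → α) → Prop, ∀ f, s f ↔ s' (e f).2 := by
    refine ⟨fun h => s (e.symm (a0, h)), fun f => ?_⟩
    apply hs
    intro v hv
    simp [e, Equiv.piEquivPiSubtypeProd, hv]
  have c1 : (Finset.univ.filter (fun f : V → α => p (fun v => f v) ∧ s f)).card =
      (Finset.univ.filter p).card * (Finset.univ.filter s').card := by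
    rw [← Finset.card_product]
    apply Finset.card_equiv e
    intro f
    simp only [Finset.mem_filter, Finset.mem_univ, true_and, Finset.mem_product, hss]
    rfl
  have c2 : (Finset.univ.filter s).card =
      Fintype.card (N → α) * (Finset.univ.filter s').card := by
    rw [← Finset.card_univ, ← Finset.card_product]
    apply Finset.card_equiv e
    intro f
    simp only [Finset.mem_filter, Finset.mem_univ, true_and, Finset.mem_product, hss]
  rw [c1, c2]
  push_cast
  rw [← mul_assoc]
  exact mul_le_mul_of_nonneg_right (by exact_mod_cast hp) (by positivity)

theorem count_nozero {X : Type} [Fintype X] [DecidableEq X] (q : ℕ) [NeZero q] :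
    (Finset.univ.filter (fun f : X → Fin q => ∀ x, f x ≠ 0)).card =
      (q - 1) ^ (Fintype.card X) := by
  have : (Finset.univ.filter (fun f : X → Fin q => ∀ x, f x ≠ 0)) =
      Fintype.piFinset (fun _ : X => Finset.univ.erase (0 : Fin q)) := by
    ext f; simp
  rw [this, Fintype.card_piFinset]
  simp

theorem count_many {X : Type} [Fintype X] [DecidableEq X] (q t : ℕ) [NeZero q] :
    (Finset.univ.filter (fun f : X → Fin q =>
      t < (Finset.univ.filter (fun x => f x = 0)).card)).card * q ^ (t + 1) ≤
      2 ^ (Fintype.card X) * q ^ (Fintype.card X) := by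
  have h1 : (Finset.univ.filter (fun f : X → Fin q =>
      t < (Finset.univ.filter (fun x => f x = 0)).card)) ⊆
      (Finset.univ.powersetCard (t + 1)).biUnion (fun T : Finset X =>
        Fintype.piFinset (fun x => if x ∈ T then {(0 : Fin q)} else Finset.univ)) := by
    intro f hf
    simp only [Finset.mem_filter, Finset.mem_univ, true_and] at hf
    obtain ⟨T, hT, hTc⟩ := Finset.exists_subset_card_eq (Nat.succ_le_of_lt hf)
    simp only [Finset.mem_biUnion, Finset.mem_powersetCard, Fintype.mem_piFinset]
    refine ⟨T, ⟨Finset.subset_univ _, hTc⟩, fun x => ?_⟩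
    split_ifs with hx
    · have := hT hx; simpa using this
    · simp
  have h2 := le_trans (Finset.card_le_card h1) Finset.card_biUnion_le
  have h3 : ∀ T ∈ (Finset.univ : Finset X).powersetCard (t + 1),
      (Fintype.piFinset (fun x => if x ∈ T then {(0 : Fin q)} else Finset.univ)).card
        * q ^ (t + 1) = q ^ (Fintype.card X) := by
    intro T hT
    rw [Finset.mem_powersetCard] at hT
    rw [Fintype.card_piFinset]
    have : ∀ x, (if x ∈ T then {(0 : Fin q)} else Finset.univ).card =
      if x ∈ T then 1 else q := by intro x; split_ifs <;> simp
    simp only [this]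
    rw [Finset.prod_ite]
    simp only [Finset.prod_const_one, one_mul, Finset.prod_const]
    rw [← pow_add, ← hT.2]
    congr 1
    rw [← Finset.compl_filter, Finset.card_compl]
    simp only [Finset.filter_univ_mem]
    have := Finset.card_le_univ T
    omega
  calc _ ≤ (∑ T ∈ (Finset.univ : Finset X).powersetCard (t + 1),
      (Fintype.piFinset (fun x => if x ∈ T then {(0 : Fin q)} else Finset.univ)).card)
        * q ^ (t + 1) := Nat.mul_le_mul_right _ h2
    _ = ((Finset.univ : Finset X).powersetCard (t + 1)).card * q ^ (Fintype.card X) := by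
        rw [Finset.sum_mul, Finset.sum_congr rfl h3]; simp
    _ ≤ _ := by
        apply Nat.mul_le_mul_right
        rw [Finset.card_powersetCard, Finset.card_univ]
        exact Nat.choose_le_two_pow _ _

theorem count_bad {X : Type} [Fintype X] [DecidableEq X] (q t k K : ℕ) [NeZero q]
    (hK : Fintype.card X ≤ K) :
    ((Finset.univ.filter (fun f : X → Fin q => (k ≤ Fintype.card X ∧ ∀ x, f x ≠ 0) ∨
      t < (Finset.univ.filter (fun x => f x = 0)).card)).card : ℝ) ≤
      ((1 - 1 / (q : ℝ)) ^ k + 2 ^ K / (q : ℝ) ^ (t + 1)) * Fintype.card (X → Fin q) := by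
  have hq0 : 0 < q := Nat.pos_of_ne_zero (NeZero.ne q)
  have hqr : (0 : ℝ) < q := by exact_mod_cast hq0
  have hq1 : (1 : ℝ) ≤ q := by exact_mod_cast hq0
  have hfr : (1 : ℝ) / q ≤ 1 := by rw [div_le_one hqr]; exact hq1
  have hfr0 : (0 : ℝ) < 1 / q := by positivity
  have h1 : ((Finset.univ.filter (fun f : X → Fin q =>
      k ≤ Fintype.card X ∧ ∀ x, f x ≠ 0)).card : ℝ) ≤
      (1 - 1 / (q : ℝ)) ^ k * (q : ℝ) ^ (Fintype.card X) := by
    by_cases hk : k ≤ Fintype.card X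
    · simp only [hk, true_and]
      rw [count_nozero]
      have : (((q - 1) ^ (Fintype.card X) : ℕ) : ℝ) =
          (1 - 1 / (q : ℝ)) ^ (Fintype.card X) * (q : ℝ) ^ (Fintype.card X) := by
        rw [← mul_pow]
        push_cast [Nat.cast_sub hq0]
        congr 1
        field_simp
      rw [this]
      apply mul_le_mul_of_nonneg_right _ (by positivity)
      exact pow_le_pow_of_le_one (by linarith) (by linarith) hk
    · simp only [hk, false_and, Finset.filter_false, Finset.card_empty, Nat.cast_zero]
      have : (0:ℝ) ≤ 1 - 1 / q := by linarith
      positivity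
  have h2 : ((Finset.univ.filter (fun f : X → Fin q =>
      t < (Finset.univ.filter (fun x => f x = 0)).card)).card : ℝ) ≤
      2 ^ K / (q : ℝ) ^ (t + 1) * (q : ℝ) ^ (Fintype.card X) := by
    have := count_many (X := X) q t
    rw [div_mul_eq_mul_div, le_div_iff₀ (by positivity)]
    refine le_trans (by exact_mod_cast this : _ ≤ (2 : ℝ) ^ (Fintype.card X) *
      (q : ℝ) ^ (Fintype.card X)) ?_
    apply mul_le_mul_of_nonneg_right _ (by positivity)
    exact pow_le_pow_right₀ (by norm_num) hK
  have h3 : (Finset.univ.filter (fun f : X → Fin q => (k ≤ Fintype.card X ∧ ∀ x, f x ≠ 0) ∨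
      t < (Finset.univ.filter (fun x => f x = 0)).card)).card ≤
      (Finset.univ.filter (fun f : X → Fin q => k ≤ Fintype.card X ∧ ∀ x, f x ≠ 0)).card +
      (Finset.univ.filter (fun f : X → Fin q =>
      t < (Finset.univ.filter (fun x => f x = 0)).card)).card := by
    rw [Finset.filter_or]
    exact Finset.card_union_le _ _
  have h3' : ((Finset.univ.filter (fun f : X → Fin q => (k ≤ Fintype.card X ∧ ∀ x, f x ≠ 0) ∨
      t < (Finset.univ.filter (fun x => f x = 0)).card)).card : ℝ) ≤
      (Finset.univ.filter (fun f : X → Fin q => k ≤ Fintype.card X ∧ ∀ x, f x ≠ 0)).card +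
      (Finset.univ.filter (fun f : X → Fin q =>
      t < (Finset.univ.filter (fun x => f x = 0)).card)).card := by exact_mod_cast h3
  have h4 : (Fintype.card (X → Fin q) : ℝ) = (q : ℝ) ^ (Fintype.card X) := by simp
  rw [h4, add_mul]
  linarith

theorem hitting {V : Type} [Fintype V] [DecidableEq V] (N : V → Finset V) (K k t q : ℕ)
    (hq : 0 < q) (hK : ∀ i, (N i).card ≤ K)
    (hdeg : ∀ v, (Finset.univ.filter (fun i => v ∈ N i)).card ≤ K)
    (hP1 : 2 * ((1 - 1 / (q : ℝ)) ^ k + 2 ^ K / (q : ℝ) ^ (t + 1)) < 1)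
    (hP2 : 4 * ((1 - 1 / (q : ℝ)) ^ k + 2 ^ K / (q : ℝ) ^ (t + 1)) * ((K * K : ℕ) : ℝ) ≤ 1) :
    ∃ C : Finset V, ∀ i, ((N i).filter (fun v => v ∈ C)).card ≤ t ∧
      (k ≤ (N i).card → ∃ v ∈ N i, v ∈ C) := by
  have : NeZero q := ⟨hq.ne'⟩
  have hqr : (0 : ℝ) < q := by exact_mod_cast hq
  have hq1 : (1 : ℝ) ≤ q := by exact_mod_cast hq
  have hfr : (1 : ℝ) / q ≤ 1 := by rw [div_le_one hqr]; exact hq1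
  have hfr0 : (0:ℝ) ≤ 1 - 1 / q := by linarith
  let p : (i : V) → (N i → Fin q) → Prop := fun i f =>
    (k ≤ Fintype.card (N i) ∧ ∀ x, f x ≠ 0) ∨
      t < (Finset.univ.filter (fun x => f x = 0)).card
  have : ∀ i, DecidablePred (p i) := fun i => Classical.decPred _
  let A : V → Finset (V → Fin q) := fun i => Finset.univ.filter (fun f => p i (fun v => f v))
  let Γ : V → Finset V := fun i => (N i).biUnion (fun v => Finset.univ.filter (fun j => v ∈ N j))
  have hA : ∀ i f, f ∈ A i ↔ p i (fun v => f v) := fun i f => by simp [A]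
  obtain ⟨ω, hω⟩ := lll A Γ ((1 - 1 / (q : ℝ)) ^ k + 2 ^ K / (q : ℝ) ^ (t + 1)) (K * K)
    (by positivity) hP1 (by
      intro i
      refine le_trans Finset.card_biUnion_le ?_
      refine le_trans (Finset.sum_le_card_nsmul _ _ K (fun v _ => hdeg v)) ?_
      rw [smul_eq_mul]
      exact Nat.mul_le_mul_right _ (hK i)) hP2 (by
      intro i S hS
      simp only [hA]
      apply count_indep (N i) (p i) (fun ω => ∀ j ∈ S, ¬ p j (fun v => ω v))
      · intro f g hfg
        have : ∀ j ∈ S, (fun v : N j => f v) = (fun v : N j => g v) := by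
          intro j hj
          funext v
          apply hfg
          intro hv
          apply hS j hj
          simp only [Γ, Finset.mem_biUnion, Finset.mem_filter, Finset.mem_univ, true_and]
          exact ⟨v, hv, v.2⟩
        constructor
        · intro h j hj; rw [← this j hj]; exact h j hj
        · intro h j hj; rw [this j hj]; exact h j hj
      · have := count_bad (X := N i) q t k K (by simpa using hK i)
        convert this using 3
        ext f; simp [p])
  refine ⟨Finset.univ.filter (fun v => ω v = 0), fun i => ?_⟩
  have := hω i
  rw [hA] at this
  simp only [p, not_or, not_and, not_lt] at this
  constructor
  · refine le_trans (le_of_eq ?_) this.2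
    rw [← Finset.card_map (Function.Embedding.subtype _)]
    congr 1
    ext v
    simp [and_comm]
  · intro hk
    have h1 := this.1 (by simpa using hk)
    push Not at h1
    obtain ⟨x, hx⟩ := h1
    exact ⟨x, x.2, by simpa using hx⟩

theorem params (d : ℕ) (hd : 1 ≤ d) : ∃ t q : ℕ, 1 ≤ t ∧ 0 < q ∧
    2 * ((1 - 1 / (q : ℝ)) ^ (6 * d * t) + 2 ^ (432 * d ^ 3 * t) / (q : ℝ) ^ (t + 1)) < 1 ∧
    4 * ((1 - 1 / (q : ℝ)) ^ (6 * d * t) + 2 ^ (432 * d ^ 3 * t) / (q : ℝ) ^ (t + 1)) *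
      (((432 * d ^ 3 * t) * (432 * d ^ 3 * t) : ℕ) : ℝ) ≤ 1 := by
  set m := d ^ 3 with hm
  have hm1 : 1 ≤ m := Nat.one_le_pow _ _ hd
  set q : ℕ := 2 ^ (433 * m) with hq
  have hq2 : (2:ℝ) ≤ q := by
    rw [hq]; push_cast
    calc (2:ℝ) = 2 ^ 1 := by norm_num
      _ ≤ _ := pow_le_pow_right₀ (by norm_num) (by omega)
  have hqr : (0 : ℝ) < q := by linarith
  set r : ℝ := 1 - 1 / (q:ℝ) with hr
  have hr1 : r < 1 := by
    have : (0:ℝ) < 1 / q := by positivity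
    linarith
  have hr2 : 1 / 2 ≤ r := by
    have : (1:ℝ) / q ≤ 1 / 2 := one_div_le_one_div_of_le (by norm_num) hq2
    linarith
  have hlim := tendsto_pow_const_mul_const_pow_of_abs_lt_one 2 (r := r)
    (by rw [abs_lt]; constructor <;> linarith)
  have hlim2 := hlim.const_mul (8 * (432 * (m:ℝ)) ^ 2)
  rw [mul_zero] at hlim2
  have hev := (hlim2.eventually (gt_mem_nhds (zero_lt_one))).and (Filter.eventually_ge_atTop 1)
  obtain ⟨t, ht, ht1⟩ := hev.exists
  have hb1 : r ^ (6 * d * t) ≤ r ^ t :=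
    pow_le_pow_of_le_one (by linarith) hr1.le (by nlinarith)
  have hb2 : 2 ^ (432 * m * t) / (q : ℝ) ^ (t + 1) ≤ r ^ t := by
    refine le_trans ?_ (pow_le_pow_left₀ (by norm_num) hr2 t)
    rw [div_le_iff₀ (by positivity), one_div, inv_pow, ← div_eq_inv_mul, le_div_iff₀ (by positivity),
      hq]
    push_cast
    rw [← pow_add, ← pow_mul]
    apply pow_le_pow_right₀ (by norm_num)
    nlinarith
  have hm1' : (1:ℝ) ≤ m := by exact_mod_cast hm1
  have ht1' : (1:ℝ) ≤ t := by exact_mod_cast ht1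
  have hrt : 0 < r ^ t := by apply pow_pos; linarith
  have hmt : (1:ℝ) ≤ (m * t) ^ 2 := one_le_pow₀ (by nlinarith)
  refine ⟨t, q, ht1, by exact_mod_cast hqr, ?_, ?_⟩
  · have : 4 * r ^ t ≤ 8 * (432 * (m:ℝ)) ^ 2 * ((t:ℝ) ^ 2 * r ^ t) := by
      have : 8 * (432 * (m:ℝ)) ^ 2 * ((t:ℝ) ^ 2 * r ^ t) = (8 * 432^2) * (((m * t) ^ 2) * r ^ t) := by
        ring
      rw [this]
      nlinarith
    linarith
  · push_cast
    calc _ ≤ 4 * (r ^ t + r ^ t) * (432 * (m:ℝ) * t * (432 * m * t)) := by gcongr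
      _ = 8 * (432 * (m:ℝ)) ^ 2 * ((t:ℝ) ^ 2 * r ^ t) := by ring
      _ ≤ 1 := ht.le

/-- The star subgraph with center `x` and leaf set `Lf`. -/
def starSub {V : Type} (G : SimpleGraph V) (x : V) (Lf : Set V) (h : ∀ v ∈ Lf, G.Adj x v) :
    G.Subgraph where
  verts := insert x Lf
  Adj a b := (a = x ∧ b ∈ Lf) ∨ (b = x ∧ a ∈ Lf)
  adj_sub := by
    rintro a b (⟨rfl, hb⟩ | ⟨rfl, ha⟩)
    · exact h _ hb
    · exact (h _ ha).symm
  edge_vert := by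
    rintro a b (⟨rfl, hb⟩ | ⟨rfl, ha⟩)
    · exact Set.mem_insert _ _
    · exact Set.mem_insert_of_mem _ ha
  symm := ⟨by
    rintro a b (h | h)
    · exact Or.inr h
    · exact Or.inl h⟩

theorem starSub_isStar {V : Type} (G : SimpleGraph V) (x : V) (Lf : Set V)
    (h : ∀ v ∈ Lf, G.Adj x v) : IsStar (starSub G x Lf h) := by
  have hx : x ∉ Lf := fun hx => G.irrefl (h x hx)
  have hxv : x ∈ (starSub G x Lf h).verts := Set.mem_insert _ _
  constructor
  · have : (starSub G x Lf h).coe = SimpleGraph.starGraph ⟨x, hxv⟩ := by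
      ext ⟨a, ha⟩ ⟨b, hb⟩
      simp only [SimpleGraph.Subgraph.coe_adj, SimpleGraph.starGraph_adj, ne_eq, Subtype.mk.injEq]
      change (a = x ∧ b ∈ Lf) ∨ (b = x ∧ a ∈ Lf) ↔ _
      change a = x ∨ a ∈ Lf at ha
      change b = x ∨ b ∈ Lf at hb
      grind
    rw [this]
    exact SimpleGraph.isTree_starGraph _
  · have key : ∀ v ∈ {v ∈ (starSub G x Lf h).verts | 1 < subdeg (starSub G x Lf h) v}, v = x := by
      rintro v ⟨hv, hd⟩
      by_contra hne
      have hsub : (starSub G x Lf h).neighborSet v ⊆ {x} := by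
        rintro w (⟨h1, _⟩ | ⟨h1, _⟩)
        · exact absurd h1 hne
        · exact h1
      have := Set.ncard_le_ncard hsub
      rw [Set.ncard_singleton] at this
      unfold subdeg at hd
      rw [Nat.card_coe_set_eq] at hd
      omega
    intro a ha b hb
    rw [key a ha, key b hb]

theorem starSub_size {V : Type} [Finite V] (G : SimpleGraph V) (x : V) (Lf : Set V)
    (h : ∀ v ∈ Lf, G.Adj x v) : Lf.ncard ≤ (starSub G x Lf h).edgeSet.ncard := by
  have hinj : Function.Injective (fun v => s(x, v)) := by
    intro a b hab
    simp only [Sym2.eq_iff] at hab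
    grind
  rw [← Set.ncard_image_of_injective Lf hinj]
  refine Set.ncard_le_ncard ?_ (Set.toFinite _)
  rintro _ ⟨v, hv, rfl⟩
  exact Or.inl ⟨rfl, hv⟩

theorem star_final {V : Type} [Fintype V] (G : SimpleGraph V) (d : ℕ) (X : Finset V) (g : V → V)
    (hg : ∀ v, v ∉ X → g v ∈ X ∧ G.Adj (g v) v)
    (hs : ∀ x ∈ X, d ≤ {v | v ∉ X ∧ g v = x}.ncard) : HasStarCover G d := by
  let e := X.equivFin.symm
  have hadj : ∀ x, ∀ v ∈ {v | v ∉ X ∧ g v = x}, G.Adj x v := by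
    rintro x v ⟨h1, rfl⟩
    exact (hg v h1).2
  refine ⟨X.card, fun i => starSub G (e i) {v | v ∉ X ∧ g v = e i} (hadj _),
    fun i => starSub_isStar _ _ _ _, fun i => le_trans (hs _ (e i).2) (starSub_size _ _ _ _),
    ?_, ?_⟩
  · intro i j hij
    have hne : (e i : V) ≠ e j := fun h => hij (e.injective (Subtype.ext h))
    rw [Set.disjoint_left]
    intro v hv hv'
    change v = e i ∨ (v ∉ X ∧ g v = e i) at hv
    change v = e j ∨ (v ∉ X ∧ g v = e j) at hv'
    have h1 := (e i).2
    have h2 := (e j).2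
    rcases hv with hv | hv <;> rcases hv' with hv' | hv'
    · exact hne (hv.symm.trans hv')
    · exact hv'.1 (hv ▸ h1)
    · exact hv.1 (hv' ▸ h2)
    · exact hne (hv.2.symm.trans hv'.2)
  · intro v
    by_cases hv : v ∈ X
    · exact ⟨e.symm ⟨v, hv⟩, Or.inl (by simp)⟩
    · exact ⟨e.symm ⟨g v, (hg v hv).1⟩, Or.inr (by simp [hv])⟩

open Classical in
/-- neighbours as a finset -/
noncomputable def nb {V : Type} [Fintype V] (G : SimpleGraph V) (v : V) : Finset V :=
  Finset.univ.filter (fun u => G.Adj v u)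

theorem mem_nb {V : Type} [Fintype V] {G : SimpleGraph V} {v u : V} :
    u ∈ nb G v ↔ G.Adj v u := by
  simp [nb]

theorem gdeg_eq {V : Type} [Fintype V] (G : SimpleGraph V) (v : V) :
    gdeg G v = (nb G v).card := by
  unfold gdeg
  rw [Nat.card_coe_set_eq, ← Set.ncard_coe_finset]
  congr 1
  ext u
  simp [mem_nb]

theorem exists_min_sub {V : Type} [Fintype V] (G : SimpleGraph V) (k : ℕ)
    (h : ∀ v, k ≤ (nb G v).card) : ∃ G' ≤ G, (∀ v, k ≤ (nb G' v).card) ∧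
      ∀ u v, G'.Adj u v → (nb G' u).card ≤ k ∨ (nb G' v).card ≤ k := by
  classical
  obtain ⟨G', hle, hmin⟩ := exists_minimal_le_of_wellFoundedLT
    (fun G' : SimpleGraph V => ∀ v, k ≤ (nb G' v).card) G h
  refine ⟨G', hle, hmin.1, ?_⟩
  intro u v huv
  by_contra hcon
  push Not at hcon
  have hle2 : G'.deleteEdges {s(u, v)} ≤ G' := SimpleGraph.deleteEdges_le _
  have := hmin.2 (y := G'.deleteEdges {s(u, v)}) (by
    intro w
    by_cases hwu : w = u
    · subst hwu
      have : (nb G' w).erase v ⊆ nb (G'.deleteEdges {s(w, v)}) w := by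
        intro a ha
        simp only [Finset.mem_erase, mem_nb, SimpleGraph.deleteEdges_adj, Set.mem_singleton_iff,
          Sym2.eq_iff] at ha ⊢
        have := huv.ne
        grind
      have h1 := Finset.card_le_card this
      have h2 := Finset.pred_card_le_card_erase (s := nb G' w) (a := v)
      omega
    · by_cases hwv : w = v
      · subst hwv
        have : (nb G' w).erase u ⊆ nb (G'.deleteEdges {s(u, w)}) w := by
          intro a ha
          simp only [Finset.mem_erase, mem_nb, SimpleGraph.deleteEdges_adj, Set.mem_singleton_iff,
            Sym2.eq_iff] at ha ⊢
          have := huv.ne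
          grind
        have h1 := Finset.card_le_card this
        have h2 := Finset.pred_card_le_card_erase (s := nb G' w) (a := u)
        omega
      · refine le_trans (hmin.1 w) (Finset.card_le_card ?_)
        intro a ha
        simp only [mem_nb, SimpleGraph.deleteEdges_adj, Set.mem_singleton_iff,
            Sym2.eq_iff] at ha ⊢
        grind) hle2
  have h3 := this huv
  simp at h3

theorem expansion {V : Type} [DecidableEq V] (S : Finset V) (L : V → Finset V) (a b e : ℕ)
    (hL : ∀ s ∈ S, a ≤ (L s).card) (hb : ∀ y, (S.filter (fun s => y ∈ L s)).card ≤ b)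
    (hab : e * b ≤ a) (hb0 : 0 < b) : e * S.card ≤ (S.biUnion L).card := by
  have h1 : S.card * a ≤ (S.biUnion L).card * b := by
    apply Finset.card_mul_le_card_mul (fun s y => y ∈ L s)
    · intro s hs
      refine le_trans (hL s hs) (Finset.card_le_card ?_)
      intro y hy
      simp only [Finset.bipartiteAbove, Finset.mem_filter, Finset.mem_biUnion]
      exact ⟨⟨s, hs, hy⟩, hy⟩
    · intro y _
      exact hb y
  have h2 : S.card * (e * b) ≤ S.card * a := Nat.mul_le_mul_left _ hab
  have h3 : (e * S.card) * b ≤ (S.biUnion L).card * b := by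
    calc _ = S.card * (e * b) := by ring
      _ ≤ _ := h2.trans h1
  exact Nat.le_of_mul_le_mul_right h3 hb0

theorem hall_final {V : Type} [Fintype V] [DecidableEq V] (G G0 : SimpleGraph V)
    (hle : G ≤ G0) (d : ℕ)
    (X : Finset V) (hdom : ∀ v, v ∉ X → ∃ x ∈ X, G.Adj x v)
    (hall : ∀ S ⊆ X, d * S.card ≤ (S.biUnion (fun x => nb G x \ X)).card) :
    HasStarCover G0 d := by
  obtain ⟨f, hf, hf2⟩ := (Finset.all_card_le_biUnion_card_iff_exists_injective
    (fun p : {x // x ∈ X} × Fin d => nb G p.1 \ X)).1 (by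
      intro s
      let S : Finset V := s.image (fun p => (p.1 : V))
      have h1 : s.card ≤ d * S.card := by
        have hinj : s.card ≤ (S ×ˢ (Finset.univ : Finset (Fin d))).card := by
          apply Finset.card_le_card_of_injOn (fun p => ((p.1 : V), p.2))
          · intro p hp
            have hp' : p ∈ s := hp
            simp only [Finset.coe_product, Set.mem_prod, Finset.coe_univ, Set.mem_univ, and_true,
              Finset.mem_coe, S]
            exact Finset.mem_image_of_mem (fun p : {x // x ∈ X} × Fin d => (p.1 : V)) hp'
          · rintro ⟨a, i⟩ _ ⟨b, j⟩ _ hab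
            simp only [Prod.mk.injEq] at hab
            exact Prod.ext (Subtype.ext hab.1) hab.2
        rw [Finset.card_product, Finset.card_univ, Fintype.card_fin] at hinj
        linarith [mul_comm d S.card]
      have h2 := hall S (by
        intro v hv
        obtain ⟨p, _, rfl⟩ := Finset.mem_image.1 hv
        exact p.1.2)
      refine h1.trans (h2.trans (Finset.card_le_card ?_))
      intro y hy
      simp only [S, Finset.mem_biUnion, Finset.mem_image] at hy ⊢
      obtain ⟨_, ⟨p, hp, rfl⟩, hy⟩ := hy
      exact ⟨p, hp, hy⟩)
  have hex : ∀ v, ∃ x, v ∉ X → (x ∈ X ∧ G.Adj x v) ∧ ∀ p, f p = v → x = p.1 := by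
    intro v
    by_cases hv : ∃ p, f p = v
    · obtain ⟨p, rfl⟩ := hv
      have := hf2 p
      rw [Finset.mem_sdiff, mem_nb] at this
      refine ⟨p.1, fun _ => ⟨⟨p.1.2, this.1⟩, ?_⟩⟩
      intro p' hp'
      rw [hf hp']
    · by_cases hvX : v ∈ X
      · exact ⟨v, fun h => absurd hvX h⟩
      · obtain ⟨x, hx⟩ := hdom v hvX
        exact ⟨x, fun _ => ⟨hx, fun p hp => absurd ⟨p, hp⟩ hv⟩⟩
  choose g hg using hex
  apply star_final G0 d X g (fun v hv => ⟨(hg v hv).1.1, hle (hg v hv).1.2⟩)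
  intro x hx
  have hinj : Function.Injective (fun i : Fin d => f (⟨x, hx⟩, i)) := by
    intro i j hij
    have := hf hij
    simpa using this
  have : (Set.range (fun i : Fin d => f (⟨x, hx⟩, i))).ncard = d := by
    rw [← Set.image_univ, Set.ncard_image_of_injective _ hinj]
    simp
  conv_lhs => rw [← this]
  refine Set.ncard_le_ncard ?_ (Set.toFinite _)
  rintro _ ⟨i, rfl⟩
  have h1 := hf2 (⟨x, hx⟩, i)
  rw [Finset.mem_sdiff] at h1
  exact ⟨h1.2, (hg _ h1.2).2 _ rfl⟩

open Classical in
/-- Invariant of the peeling process: `Z` are forced centers, `Y` forced leaves, and `R` records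
which leaves may be used by which of the centers added after `B`. -/
structure PeelInv {V : Type} [Fintype V] [DecidableEq V] (G : SimpleGraph V) (B : Finset V) (h k2 : ℕ)
    (Z Y : Finset V) (R : V → V → Prop) : Prop where
  sub : B ⊆ Z
  disj : Disjoint Z Y
  indep : ∀ u ∈ Z, ∀ v ∈ Z, ¬ G.Adj u v
  dom : ∀ y ∈ Y, ∃ z ∈ Z, G.Adj z y
  adj : ∀ z y, R z y → G.Adj z y
  many : ∀ z ∈ Z, z ∉ B → h ≤ (Y.filter (fun y => R z y)).card
  few : ∀ y ∈ Y, ((Z \ B).filter (fun z => R z y)).card + (nb G y \ (Z ∪ Y)).card ≤ k2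

theorem peel {V : Type} [Fintype V] [DecidableEq V] (G : SimpleGraph V) (B : Finset V)
    (h k2 k : ℕ) (hk : h + k2 ≤ k) (hdeg : ∀ v, k ≤ (nb G v).card) :
    ∀ (n : ℕ) (Z Y : Finset V) (R : V → V → Prop), (Finset.univ \ (Z ∪ Y)).card = n →
      PeelInv G B h k2 Z Y R → ∃ Z Y R, PeelInv G B h k2 Z Y R ∧
        ∀ w, w ∉ Z → w ∉ Y → k2 ≤ (nb G w \ (Z ∪ Y)).card := by
  classical
  intro n
  induction n using Nat.strong_induction_on with
  | _ n ih =>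
  intro Z Y R hn hinv
  by_cases hfin : ∀ w, w ∉ Z → w ∉ Y → k2 ≤ (nb G w \ (Z ∪ Y)).card
  · exact ⟨Z, Y, R, hinv, hfin⟩
  push Not at hfin
  obtain ⟨w, hwZ, hwY, hw⟩ := hfin
  have hR0 : ∀ z ∈ Z, ∀ y, R z y → G.Adj z y := fun z _ y => hinv.adj z y
  by_cases hz : ∃ z ∈ Z, G.Adj z w
  · -- move `w` to `Y`
    obtain ⟨R', hR'⟩ : ∃ R' : V → V → Prop, ∀ z y, R' z y ↔ (R z y ∧ y ≠ w) :=
      ⟨fun z y => R z y ∧ y ≠ w, fun _ _ => Iff.rfl⟩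
    refine ih _ ?_ Z (insert w Y) R' rfl ?_
    · rw [← hn]
      apply Finset.card_lt_card
      refine ⟨?_, fun hsub => ?_⟩
      · intro a; grind
      · have : w ∈ Finset.univ \ (Z ∪ Y) := by simp [hwZ, hwY]
        have := hsub this
        simp at this
    · refine ⟨hinv.sub, ?_, hinv.indep, ?_, fun z y hzy => hinv.adj z y ((hR' z y).1 hzy).1, ?_, ?_⟩
      · rw [Finset.disjoint_insert_right]; exact ⟨hwZ, hinv.disj⟩
      · intro y hy
        rcases Finset.mem_insert.1 hy with rfl | hy
        · exact hz
        · exact hinv.dom y hy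
      · intro z hz1 hz2
        refine le_trans (hinv.many z hz1 hz2) (Finset.card_le_card ?_)
        intro y hy
        simp only [Finset.mem_filter, Finset.mem_insert, hR'] at hy ⊢
        exact ⟨Or.inr hy.1, hy.2, fun h => hwY (h ▸ hy.1)⟩
      · intro y hy
        have hmono : (nb G y \ (Z ∪ insert w Y)).card ≤ (nb G y \ (Z ∪ Y)).card := by
          apply Finset.card_le_card
          intro a; grind
        rcases Finset.mem_insert.1 hy with rfl | hy
        · have : ((Z \ B).filter (fun z => R' z y)) = ∅ := by
            apply Finset.filter_false_of_mem
            intro z _ hc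
            exact ((hR' _ _).1 hc).2 rfl
          rw [this, Finset.card_empty]
          omega
        · have h1 := hinv.few y hy
          have h2 : ((Z \ B).filter (fun z => R' z y)).card ≤
              ((Z \ B).filter (fun z => R z y)).card := by
            apply Finset.card_le_card
            intro z hz'
            simp only [Finset.mem_filter, hR'] at hz' ⊢
            exact ⟨hz'.1, hz'.2.1⟩
          omega
  · -- move `w` to `Z`
    push Not at hz
    obtain ⟨R', hR'⟩ : ∃ R' : V → V → Prop, ∀ z y, R' z y ↔
        (if z = w then G.Adj z y else R z y) :=
      ⟨fun z y => if z = w then G.Adj z y else R z y, fun _ _ => Iff.rfl⟩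
    have hwB : w ∉ B := fun hb => hwZ (hinv.sub hb)
    refine ih _ ?_ (insert w Z) Y R' rfl ?_
    · rw [← hn]
      apply Finset.card_lt_card
      refine ⟨?_, fun hsub => ?_⟩
      · intro a; grind
      · have : w ∈ Finset.univ \ (Z ∪ Y) := by simp [hwZ, hwY]
        have := hsub this
        simp at this
    · refine ⟨hinv.sub.trans (Finset.subset_insert _ _), ?_, ?_, ?_, ?_, ?_, ?_⟩
      · rw [Finset.disjoint_insert_left]; exact ⟨hwY, hinv.disj⟩
      · intro u hu v hv huv
        rcases Finset.mem_insert.1 hu with rfl | hu' <;>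
          rcases Finset.mem_insert.1 hv with rfl | hv'
        · exact G.irrefl huv
        · exact hz v hv' huv.symm
        · exact hz u hu' huv
        · exact hinv.indep u hu' v hv' huv
      · intro y hy
        obtain ⟨z, hz1, hz2⟩ := hinv.dom y hy
        exact ⟨z, Finset.mem_insert_of_mem hz1, hz2⟩
      · intro z y hzy
        simp only [hR'] at hzy
        split_ifs at hzy with hc
        · exact hzy
        · exact hinv.adj z y hzy
      · intro z hz1 hz2
        rcases Finset.mem_insert.1 hz1 with rfl | hz1
        · have hsub : nb G z ⊆ (Y.filter (fun y => R' z y)) ∪ (nb G z \ (Z ∪ Y)) := by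
            intro a ha
            have ha' := mem_nb.1 ha
            have haZ : a ∉ Z := fun hc => hz a hc ha'.symm
            simp only [Finset.mem_union, Finset.mem_filter, Finset.mem_sdiff, hR', if_true]
            grind
          have h1 := (Finset.card_le_card hsub).trans (Finset.card_union_le _ _)
          have h2 := hdeg z
          omega
        · refine le_trans (hinv.many z hz1 hz2) (Finset.card_le_card ?_)
          have hne : z ≠ w := fun hc => hwZ (hc ▸ hz1)
          intro y hy
          simp only [Finset.mem_filter, hR', hne, if_false] at hy ⊢
          exact hy
      · intro y hy
        have h1 := hinv.few y hy
        by_cases hyw : G.Adj y w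
        · have h2 : ((insert w Z \ B).filter (fun z => R' z y)) ⊆
              insert w ((Z \ B).filter (fun z => R z y)) := by
            intro z hz'
            simp only [Finset.mem_filter, Finset.mem_insert, Finset.mem_sdiff, hR'] at hz' ⊢
            grind
          have h3 := (Finset.card_le_card h2).trans (Finset.card_insert_le _ _)
          have h4 : insert w (nb G y \ (insert w Z ∪ Y)) ⊆ nb G y \ (Z ∪ Y) := by
            intro a ha
            simp only [Finset.mem_insert, Finset.mem_sdiff, Finset.mem_union, mem_nb] at ha ⊢
            grind
          have h5 := Finset.card_le_card h4
          rw [Finset.card_insert_of_notMem (by simp)] at h5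
          omega
        · have h2 : ((insert w Z \ B).filter (fun z => R' z y)) ⊆
              ((Z \ B).filter (fun z => R z y)) := by
            intro z hz'
            simp only [Finset.mem_filter, Finset.mem_insert, Finset.mem_sdiff, hR'] at hz' ⊢
            have := G.adj_comm y w
            grind
          have h3 := Finset.card_le_card h2
          have h4 : (nb G y \ (insert w Z ∪ Y)) ⊆ nb G y \ (Z ∪ Y) := by
            intro a ha
            simp only [Finset.mem_insert, Finset.mem_sdiff, Finset.mem_union, mem_nb] at ha ⊢
            grind
          have h5 := Finset.card_le_card h4
          omega

theorem main_cover {V : Type} [Fintype V] [DecidableEq V] (G G0 : SimpleGraph V) (hle : G ≤ G0)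
    (e t q k2 k K K2 : ℕ) (he : 1 ≤ e) (ht : 1 ≤ t) (hq : 0 < q) (hk2 : k2 = 6 * e * t)
    (hk : k = 6 * e * k2) (hK2 : K2 = 6 * e * k) (hK : K = 2 * K2)
    (hP1 : 2 * ((1 - 1 / (q : ℝ)) ^ k2 + 2 ^ K / (q : ℝ) ^ (t + 1)) < 1)
    (hP2 : 4 * ((1 - 1 / (q : ℝ)) ^ k2 + 2 ^ K / (q : ℝ) ^ (t + 1)) * ((K * K : ℕ) : ℝ) ≤ 1)
    (hdeg : ∀ v, k ≤ (nb G v).card)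
    (hmin : ∀ u v, G.Adj u v → (nb G u).card ≤ k ∨ (nb G v).card ≤ k) :
    HasStarCover G0 e := by
  classical
  have e1 : e * t ≤ k2 := by rw [hk2]; nlinarith [Nat.zero_le (e * t)]
  have e2 : t ≤ e * t := Nat.le_mul_of_pos_left _ he
  have e3 : k2 ≤ e * k2 := Nat.le_mul_of_pos_left _ he
  have e4 : k ≤ e * k := Nat.le_mul_of_pos_left _ he
  have e5 : k = 6 * (e * k2) := by rw [hk]; ring
  have e6 : K2 = 6 * (e * k) := by rw [hK2]; ring
  have e7 : k2 = 6 * (e * t) := by rw [hk2]; ring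
  set B : Finset V := Finset.univ.filter (fun v => K ≤ (nb G v).card) with hB
  have hBnb : ∀ b ∈ B, ∀ v, G.Adj b v → (nb G v).card ≤ k := by
    intro b hb v hv
    have hb' : K ≤ (nb G b).card := by simpa [hB] using hb
    rcases hmin b v hv with h1 | h1
    · omega
    · exact h1
  have hinit : PeelInv G B (3 * (e * k2)) k2 B ∅ (fun _ _ => False) := by
    refine ⟨subset_rfl, by simp, ?_, by simp, by simp, ?_, by simp⟩
    · intro u hu v hv huv
      have h1 := hBnb u hu v huv
      have h2 : K ≤ (nb G v).card := by simpa [hB] using hv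
      omega
    · intro z h1 h2
      exact absurd h1 h2
  obtain ⟨Z, Y, R, hinv, hW⟩ := peel G B (3 * (e * k2)) k2 k (by omega) hdeg _ B ∅ _ rfl hinit
  -- the sets for the local lemma
  have hNex : ∀ i, ∃ N : Finset V, N ⊆ nb G i \ (Z ∪ Y) ∧ N.card ≤ K ∧
      (i ∉ Z → i ∉ Y → N = nb G i \ (Z ∪ Y)) ∧
      (i ∈ B → K2 ≤ (nb G i \ (Z ∪ Y)).card → N.card = K2) := by
    intro i
    by_cases hi : i ∈ B
    · have hiZ := hinv.sub hi
      by_cases hc : K2 ≤ (nb G i \ (Z ∪ Y)).card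
      · obtain ⟨N, hN1, hN2⟩ := Finset.exists_subset_card_eq hc
        exact ⟨N, hN1, by omega, fun h => absurd hiZ h, fun _ _ => hN2⟩
      · exact ⟨∅, by simp, by simp, fun h => absurd hiZ h, fun _ h => absurd h hc⟩
    · refine ⟨nb G i \ (Z ∪ Y), subset_rfl, ?_, fun _ _ => rfl, fun h => absurd h hi⟩
      have h1 : ¬ K ≤ (nb G i).card := by simpa [hB] using hi
      have h2 := Finset.card_le_card (Finset.sdiff_subset (s := nb G i) (t := Z ∪ Y))
      omega
  choose N hN1 hN2 hN3 hN4 using hNex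
  obtain ⟨C0, hC0⟩ := hitting N K k2 t q hq hN2 (by
    intro v
    by_cases hv : v ∈ Z ∪ Y
    · have : (Finset.univ.filter (fun i => v ∈ N i)) = ∅ := by
        apply Finset.filter_false_of_mem
        intro i _ hi
        exact (Finset.mem_sdiff.1 (hN1 i hi)).2 hv
      rw [this]; simp
    · have hvB : v ∉ B := fun h => hv (Finset.mem_union_left _ (hinv.sub h))
      have h1 : ¬ K ≤ (nb G v).card := by simpa [hB] using hvB
      have h2 : (Finset.univ.filter (fun i => v ∈ N i)) ⊆ nb G v := by
        intro i hi
        have hi' : v ∈ N i := by simpa using hi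
        exact mem_nb.2 (mem_nb.1 (Finset.mem_sdiff.1 (hN1 i hi')).1).symm
      have := Finset.card_le_card h2
      omega) hP1 hP2
  set C : Finset V := C0 \ (Z ∪ Y) with hC
  set X : Finset V := Z ∪ C with hX
  have hYX : ∀ y ∈ Y, y ∉ X := by
    intro y hy hyX
    rcases Finset.mem_union.1 hyX with h1 | h1
    · exact (Finset.disjoint_left.1 hinv.disj h1) hy
    · exact (Finset.mem_sdiff.1 h1).2 (Finset.mem_union_right _ hy)
  have hWN : ∀ w, w ∉ Z → w ∉ Y → ((nb G w \ (Z ∪ Y)).filter (fun v => v ∈ C)).card ≤ t ∧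
      ∃ v ∈ nb G w, v ∈ C := by
    intro w h1 h2
    have h3 := hC0 w
    rw [hN3 w h1 h2] at h3
    constructor
    · refine le_trans (Finset.card_le_card ?_) h3.1
      intro a ha
      simp only [Finset.mem_filter, hC, Finset.mem_sdiff] at ha ⊢
      exact ⟨ha.1, ha.2.1⟩
    · obtain ⟨v, hv1, hv2⟩ := h3.2 (hW w h1 h2)
      rw [Finset.mem_sdiff] at hv1
      exact ⟨v, hv1.1, Finset.mem_sdiff.2 ⟨hv2, hv1.2⟩⟩
  apply hall_final G G0 hle e X
  · intro v hv
    have hvZ : v ∉ Z := fun h => hv (Finset.mem_union_left _ h)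
    by_cases hvY : v ∈ Y
    · obtain ⟨z, hz, hzv⟩ := hinv.dom v hvY
      exact ⟨z, Finset.mem_union_left _ hz, hzv⟩
    · obtain ⟨c, hc1, hc2⟩ := (hWN v hvZ hvY).2
      exact ⟨c, Finset.mem_union_right _ hc2, (mem_nb.1 hc1).symm⟩
  · intro S hS
    -- centers in B
    have hx1 : (3 * e) * (S.filter (fun x => x ∈ B)).card ≤
        (S.biUnion (fun x => nb G x \ X)).card := by
      refine le_trans (expansion _ (fun x => nb G x \ X) (3 * (e * k)) k (3 * e) ?_ ?_
        (by rw [mul_assoc]) (by nlinarith)) (Finset.card_le_card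
        (Finset.biUnion_subset_biUnion_of_subset_left _ (Finset.filter_subset _ _)))
      · intro b hb
        have hbB := (Finset.mem_filter.1 hb).2
        have hbZ := hinv.sub hbB
        have hbK : K ≤ (nb G b).card := by simpa [hB] using hbB
        have hnZ : ∀ a ∈ nb G b, a ∉ Z := fun a ha haZ => hinv.indep b hbZ a haZ (mem_nb.1 ha)
        by_cases hc : K2 ≤ (nb G b \ (Z ∪ Y)).card
        · have h1 := hN4 b hbB hc
          have h2 := (hC0 b).1
          have h3 : N b ⊆ (N b).filter (fun v => v ∈ C0) ∪ (nb G b \ X) := by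
            intro a ha
            have ha' := Finset.mem_sdiff.1 (hN1 b ha)
            have := hnZ a ha'.1
            simp only [Finset.mem_union, Finset.mem_filter, Finset.mem_sdiff, hX, hC]
            grind
          have h4 := (Finset.card_le_card h3).trans (Finset.card_union_le _ _)
          omega
        · have h3 : nb G b ⊆ (nb G b \ (Z ∪ Y)) ∪ (nb G b \ X) := by
            intro a ha
            have := hnZ a ha
            have := hYX a
            simp only [Finset.mem_union, Finset.mem_sdiff]
            grind
          have h4 := (Finset.card_le_card h3).trans (Finset.card_union_le _ _)
          omega
      · intro y
        by_cases hy : ∃ b ∈ B, G.Adj b y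
        · obtain ⟨b, hb, hby⟩ := hy
          refine le_trans (Finset.card_le_card ?_) (hBnb b hb y hby)
          intro a ha
          simp only [Finset.mem_filter, Finset.mem_sdiff, mem_nb] at ha ⊢
          exact ha.2.1.symm
        · rw [Finset.card_eq_zero.2]
          · exact Nat.zero_le _
          · apply Finset.filter_false_of_mem
            intro b hb hc
            exact hy ⟨b, (Finset.mem_filter.1 hb).2, mem_nb.1 (Finset.mem_sdiff.1 hc).1⟩
    -- late centers
    have hx2 : (3 * e) * (S.filter (fun x => x ∈ Z ∧ x ∉ B)).card ≤
        (S.biUnion (fun x => nb G x \ X)).card := by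
      refine le_trans (expansion _ (fun x => Y.filter (fun y => R x y)) (3 * (e * k2)) k2 (3 * e)
        ?_ ?_ (by rw [mul_assoc]) (by omega)) (Finset.card_le_card ?_)
      · intro z hz
        have hz' := (Finset.mem_filter.1 hz).2
        exact hinv.many z hz'.1 hz'.2
      · intro y
        by_cases hy : y ∈ Y
        · refine le_trans (Finset.card_le_card ?_) (le_trans (Nat.le_add_right _ _)
            (hinv.few y hy))
          intro z hz
          simp only [Finset.mem_filter, Finset.mem_sdiff] at hz ⊢
          exact ⟨hz.1.2, hz.2.2⟩
        · rw [Finset.card_eq_zero.2]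
          · exact Nat.zero_le _
          · apply Finset.filter_false_of_mem
            intro b hb hc
            exact hy (Finset.mem_filter.1 hc).1
      · intro y hy
        simp only [Finset.mem_biUnion, Finset.mem_filter, Finset.mem_sdiff, mem_nb] at hy ⊢
        obtain ⟨z, hz, hy1, hy2⟩ := hy
        exact ⟨z, hz.1, hinv.adj z y hy2, hYX y hy1⟩
    -- random centers
    have hx3 : (3 * e) * (S.filter (fun x => x ∈ C)).card ≤
        (S.biUnion (fun x => nb G x \ X)).card := by
      refine le_trans (expansion _ (fun x => (nb G x \ (Z ∪ Y)) \ C) (3 * (e * t)) t (3 * e)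
        ?_ ?_ (by rw [mul_assoc]) (by omega)) (Finset.card_le_card ?_)
      · intro c hc
        have hc' := (Finset.mem_sdiff.1 (Finset.mem_filter.1 hc).2).2
        have hcZ : c ∉ Z := fun h => hc' (Finset.mem_union_left _ h)
        have hcY : c ∉ Y := fun h => hc' (Finset.mem_union_right _ h)
        have h1 := hW c hcZ hcY
        have h2 := (hWN c hcZ hcY).1
        have h3 : nb G c \ (Z ∪ Y) ⊆ (nb G c \ (Z ∪ Y)).filter (fun v => v ∈ C) ∪
            ((nb G c \ (Z ∪ Y)) \ C) := by
          intro a ha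
          rw [Finset.mem_union, Finset.mem_filter, Finset.mem_sdiff (t := C)]
          tauto
        have h4 := (Finset.card_le_card h3).trans (Finset.card_union_le _ _)
        omega
      · intro y
        by_cases hy : y ∈ Z ∪ Y
        · rw [Finset.card_eq_zero.2]
          · exact Nat.zero_le _
          · apply Finset.filter_false_of_mem
            intro b hb hc
            exact (Finset.mem_sdiff.1 (Finset.mem_sdiff.1 hc).1).2 hy
        · refine le_trans (Finset.card_le_card ?_) (hWN y
            (fun h => hy (Finset.mem_union_left _ h))
            (fun h => hy (Finset.mem_union_right _ h))).1
          intro c hc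
          obtain ⟨hc1, hc2⟩ := Finset.mem_filter.1 hc
          have hc3 := (Finset.mem_filter.1 hc1).2
          have hc4 := (Finset.mem_sdiff.1 (Finset.mem_sdiff.1 hc2).1).1
          exact Finset.mem_filter.2 ⟨Finset.mem_sdiff.2 ⟨mem_nb.2 (mem_nb.1 hc4).symm,
            (Finset.mem_sdiff.1 hc3).2⟩, hc3⟩
      · intro y hy
        simp only [Finset.mem_biUnion, Finset.mem_filter, Finset.mem_sdiff, Finset.mem_union,
          hX] at hy ⊢
        obtain ⟨z, hz, hy1, hy2⟩ := hy
        exact ⟨z, hz.1, hy1.1, by tauto⟩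
    have hcov : S ⊆ (S.filter (fun x => x ∈ B) ∪ S.filter (fun x => x ∈ Z ∧ x ∉ B)) ∪
        S.filter (fun x => x ∈ C) := by
      intro x hx
      have := Finset.mem_union.1 (hS hx)
      by_cases hxB : x ∈ B
      · exact Finset.mem_union_left _ (Finset.mem_union_left _ (Finset.mem_filter.2 ⟨hx, hxB⟩))
      · rcases this with h | h
        · exact Finset.mem_union_left _ (Finset.mem_union_right _
            (Finset.mem_filter.2 ⟨hx, h, hxB⟩))
        · exact Finset.mem_union_right _ (Finset.mem_filter.2 ⟨hx, h⟩)
    have h1 := Finset.card_le_card hcov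
    have h2 := Finset.card_union_le (S.filter (fun x => x ∈ B) ∪
      S.filter (fun x => x ∈ Z ∧ x ∉ B)) (S.filter (fun x => x ∈ C))
    have h3 := Finset.card_union_le (S.filter (fun x => x ∈ B))
      (S.filter (fun x => x ∈ Z ∧ x ∉ B))
    have h4 : e * S.card ≤ e * ((S.filter (fun x => x ∈ B)).card +
      (S.filter (fun x => x ∈ Z ∧ x ∉ B)).card + (S.filter (fun x => x ∈ C)).card) :=
      Nat.mul_le_mul_left _ (by omega)
    nlinarith

/-- For every natural number `d` there exists `f d` such that every finite simple graph of
minimum degree at least `f d` has a star-cover in which every star has size at least `d`. -/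
theorem stmt_2 (d : ℕ) :
    ∃ f : ℕ, ∀ (V : Type) [Fintype V] (G : SimpleGraph V),
      (∀ v, f ≤ gdeg G v) → HasStarCover G d := by
  obtain ⟨t, q, ht, hq, hP1, hP2⟩ := params (d + 1) (by omega)
  refine ⟨6 * (d + 1) * (6 * (d + 1) * t), ?_⟩
  intro V _ G hG
  classical
  obtain ⟨G', hle, h1, h2⟩ := exists_min_sub G _ (fun v => (gdeg_eq G v) ▸ hG v)
  have hKe : 432 * (d + 1) ^ 3 * t =
    2 * (6 * (d + 1) * (6 * (d + 1) * (6 * (d + 1) * t))) := by ring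
  rw [hKe] at hP1 hP2
  obtain ⟨m, S, hS1, hS2, hS3⟩ := main_cover G' G hle (d + 1) t q _ _ _ _ (by omega) ht hq
    rfl rfl rfl rfl hP1 hP2 h1 h2
  exact ⟨m, S, hS1, fun i => le_trans (Nat.le_succ d) (hS2 i), hS3⟩
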